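/- Let n be a nonnegative integer and let a, c ∈ ℂ satisfy 2c+n ≠ 0, c + j ≠ 0 for 0 ≤ j ≤ max(n−1, ⌊n/2⌋), and 1−c−n+j ≠ 0 for 0 ≤ j ≤ ⌊n/2⌋−1. Then Σ_{k=0}^{⌊n/2⌋} (−n/2)_k ((1−n)/2)_k (−a)_k (a+1)_k / ((1/2)_k (c+1)_k (1−c−n)_k · k!) = c·((c+a+1)_n + (c−a)_n) / ((2c+n)(c)_n). (Terminating balanced ₄F₃-series identity, the case b = (a−c)/(2a+n) of the balanced series identity with free parameter b; the left-hand side is ₄F₃[−n/2, (1−n)/2, −a, a+1; 1/2, c+1, 1−c−n; 1].) -/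

import Mathlib

/-- Rising factorial (Pochhammer symbol) of a complex number:
`poch x 0 = 1` and `poch x (m+1) = poch x m * (x + m)`. -/
noncomputable def poch (x : ℂ) : ℕ → ℂ
  | 0 => 1
  | m + 1 => poch x m * (x + (m : ℂ))

theorem poch_zero' (x : ℂ) : poch x 0 = 1 := rfl

theorem poch_succ' (x : ℂ) (m : ℕ) : poch x (m + 1) = poch x m * (x + (m : ℂ)) := rfl

theorem poch_left (x : ℂ) (m : ℕ) : poch x (m + 1) = x * poch (x + 1) m := by
  induction m with
  | zero => simp [poch_succ', poch_zero']
  | succ m ih =>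
    rw [poch_succ', ih, poch_succ']
    push_cast
    ring

theorem poch_add' (x : ℂ) (k m : ℕ) : poch x (k + m) = poch x k * poch (x + k) m := by
  induction m with
  | zero => simp [poch_zero']
  | succ m ih =>
    rw [← add_assoc, poch_succ', ih, poch_succ']
    push_cast
    ring

theorem poch_ne (x : ℂ) (k : ℕ) (h : ∀ j < k, x + (j : ℂ) ≠ 0) : poch x k ≠ 0 := by
  induction k with
  | zero => simp [poch_zero']
  | succ k ih =>
    rw [poch_succ']
    exact mul_ne_zero (ih fun j hj => h j (by omega)) (h k (by omega))

/-- binomial ratio over the complex numbers -/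
theorem chooseC (n j : ℕ) :
    (n.choose (j + 1) : ℂ) * ((j : ℂ) + 1) = (n.choose j : ℂ) * ((n : ℂ) - j) := by
  rcases le_or_gt j n with h | h
  · have := Nat.choose_succ_right_eq n j
    have h2 : ((n.choose (j + 1) * (j + 1) : ℕ) : ℂ) = ((n.choose j * (n - j) : ℕ) : ℂ) := by
      rw [this]
    push_cast [Nat.cast_sub h] at h2
    exact h2
  · simp [Nat.choose_eq_zero_of_lt h, Nat.choose_eq_zero_of_lt (Nat.lt_succ_of_lt h)]

noncomputable def rr (c : ℂ) (n k : ℕ) : ℂ :=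
  (n.choose (2 * k) : ℂ) * (poch (c + k) (n - 2 * k) + poch (c + k + 1) (n - 2 * k))

noncomputable def dd (c : ℂ) (n k : ℕ) : ℂ :=
  2 * (n.choose (2 * k + 1) : ℂ) * poch (c + k + 1) (n - 2 * k - 1)

noncomputable def ee (a : ℂ) (k : ℕ) : ℂ := (-1) ^ k * (poch (-a) k * poch (a + 1) k)

theorem ee_succ (a : ℂ) (k : ℕ) :
    ee a (k + 1) = ee a k * ((a + 1 / 2) ^ 2 - ((k : ℂ) + 1 / 2) ^ 2) := by
  simp only [ee, poch_succ', pow_succ]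
  ring

theorem dd_zero (c : ℂ) (n k : ℕ) (h : n < 2 * k + 1) : dd c n k = 0 := by
  simp [dd, Nat.choose_eq_zero_of_lt h]

theorem rr_zero (c : ℂ) (n k : ℕ) (h : n < 2 * k) : rr c n k = 0 := by
  simp [rr, Nat.choose_eq_zero_of_lt h]

theorem dd_rec (c : ℂ) (n k : ℕ) :
    dd c (n + 1) k = (c + 1 / 2 + n) * dd c n k + rr c n k := by
  rcases lt_trichotomy n (2 * k) with h | h | h
  · rw [dd_zero _ _ _ (by omega), dd_zero _ _ _ (by omega), rr_zero _ _ _ h]; simp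
  · subst h
    rw [dd_zero c (2 * k) k (by omega)]
    simp [dd, rr, poch_zero']
    norm_num
  · obtain ⟨t, rfl⟩ : ∃ t, n = 2 * k + 1 + t := ⟨n - (2 * k + 1), by omega⟩
    have e1 : 2 * k + 1 + t + 1 - 2 * k - 1 = t + 1 := by omega
    have e2 : 2 * k + 1 + t - 2 * k - 1 = t := by omega
    have e3 : 2 * k + 1 + t - 2 * k = t + 1 := by omega
    have hp := chooseC (2 * k + 1 + t) (2 * k)
    have hs : ((2 * k + 1 + t + 1).choose (2 * k + 1) : ℂ)
        = (2 * k + 1 + t).choose (2 * k) + (2 * k + 1 + t).choose (2 * k + 1) := by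
      rw [Nat.choose_succ_succ]; push_cast; ring
    simp only [dd, rr, e1, e2, e3, hs, poch_left (c + k) t, poch_succ' (c + k + 1) t]
    generalize ((2 * k + 1 + t).choose (2 * k) : ℂ) = p at *
    generalize ((2 * k + 1 + t).choose (2 * k + 1) : ℂ) = q at *
    push_cast at *
    linear_combination (poch (c + k + 1) t) * hp * (-1)

theorem rr_rec0 (c : ℂ) (n : ℕ) :
    rr c (n + 1) 0 = (c + 1 / 2 + n) * rr c n 0 + (1 / 2) ^ 2 * dd c n 0 := by
  rcases n with _ | t
  · simp [rr, dd, poch_zero', poch_succ']; ring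
  · simp [rr, dd]
    rw [poch_left c (t + 1), poch_left c t, poch_succ' (c + 1) (t + 1), poch_succ' (c + 1) t]
    push_cast
    ring

theorem rr_rec (c : ℂ) (n k : ℕ) :
    rr c (n + 1) (k + 1) = (c + 1 / 2 + n) * rr c n (k + 1) + dd c n k
      + ((k : ℂ) + 1 + 1 / 2) ^ 2 * dd c n (k + 1) := by
  rcases lt_or_ge n (2 * k + 1) with h | h
  · rw [dd_zero _ _ _ (by omega), dd_zero _ _ _ (by omega), rr_zero _ _ _ (by omega),
      rr_zero _ _ _ (by omega)]; simp
  obtain ⟨t, rfl⟩ : ∃ t, n = 2 * k + 1 + t := ⟨n - (2 * k + 1), by omega⟩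
  have hs : ((2 * k + 1 + t + 1).choose (2 * k + 2) : ℂ)
      = (2 * k + 1 + t).choose (2 * k + 1) + (2 * k + 1 + t).choose (2 * k + 2) := by
    rw [Nat.choose_succ_succ]; push_cast; ring
  have h1 := chooseC (2 * k + 1 + t) (2 * k + 1)
  have h2 := chooseC (2 * k + 1 + t) (2 * k + 2)
  have e0 : 2 * (k + 1) = 2 * k + 2 := by ring
  have e1 : 2 * k + 1 + t + 1 - (2 * k + 2) = t := by omega
  have e2 : 2 * k + 1 + t - (2 * k + 2) = t - 1 := by omega
  have e3 : 2 * k + 1 + t - 2 * k - 1 = t := by omega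
  have ec : c + ((k + 1 : ℕ) : ℂ) = c + k + 1 := by push_cast; ring
  simp only [dd, rr, e0, e1, e2, e3, hs, ec]
  have e4 : 2 * k + 2 + 1 = 2 * k + 3 := by ring
  have e5 : 2 * k + 1 + 1 = 2 * k + 2 := by ring
  rw [e4] at h2
  rw [e5] at h1
  rw [e4]
  rcases t with _ | _ | t
  · simp [poch_zero']; norm_num
    right; exact Nat.choose_eq_zero_of_lt (by omega)
  · have z : (2 * k + 1 + (0 + 1)).choose (2 * k + 3) = 0 := Nat.choose_eq_zero_of_lt (by omega)
    have o : (2 * k + 1 + (0 + 1)).choose (2 * k + 2) = 1 := by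
      rw [show 2 * k + 1 + (0 + 1) = 2 * k + 2 by ring]; simp
    have o2 : (2 * k + 1 + (0 + 1)).choose (2 * k + 1) = 2 * k + 2 := by
      rw [show 2 * k + 1 + (0 + 1) = 2 * k + 1 + 1 by ring]; simp
    rw [z, o, o2]
    simp [poch_zero', poch_succ']
    ring
  · have e6 : t + 1 + 1 - 1 = t + 1 := by omega
    have e7 : t + 1 - 1 = t := by omega
    simp only [e6, e7]
    rw [poch_left (c + k + 1) (t + 1), poch_left (c + k + 1) t,
      poch_succ' (c + k + 1 + 1) (t + 1), poch_succ' (c + k + 1 + 1) t]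
    generalize ((2 * k + 1 + (t + 1 + 1)).choose (2 * k + 1) : ℂ) = p at *
    generalize ((2 * k + 1 + (t + 1 + 1)).choose (2 * k + 2) : ℂ) = q at *
    generalize ((2 * k + 1 + (t + 1 + 1)).choose (2 * k + 3) : ℂ) = r at *
    generalize poch (c + k + 1 + 1) t = P at *
    have hk2 : (2 * (k : ℂ) + 2) ≠ 0 := by
      have : ((2 * k + 2 : ℕ) : ℂ) ≠ 0 := Nat.cast_ne_zero.mpr (by omega)
      push_cast at this; exact this
    have hk3 : (2 * (k : ℂ) + 3) ≠ 0 := by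
      have : ((2 * k + 3 : ℕ) : ℂ) ≠ 0 := Nat.cast_ne_zero.mpr (by omega)
      push_cast at this; exact this
    push_cast at *
    have hq : q = p * (t + 2) / (2 * k + 2) := by
      rw [eq_div_iff hk2]; linear_combination h1
    have hr : r = q * (t + 1) / (2 * k + 3) := by
      rw [eq_div_iff hk3]; linear_combination h2
    rw [hr, hq]
    field_simp
    ring

theorem two_poch (a c : ℂ) (N : ℕ) : ∀ n : ℕ, n ≤ 2 * N + 1 →
    2 * poch (c + a + 1) n = ∑ k ∈ Finset.range (N + 1), rr c n k * ee a k
      + (a + 1 / 2) * ∑ k ∈ Finset.range (N + 1), dd c n k * ee a k := by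
  intro n
  induction n with
  | zero =>
    intro _
    rw [Finset.sum_range_succ', Finset.sum_eq_zero (s := Finset.range N),
      Finset.sum_eq_zero (s := Finset.range (N + 1))]
    · simp [rr, ee, poch_zero']; norm_num
    · intro k _; rw [dd_zero _ _ _ (by omega)]; simp
    · intro k _; rw [rr_zero _ _ _ (by omega)]; simp
  | succ n ih =>
    intro hn
    have ih := ih (by omega)
    have hD : ∑ k ∈ Finset.range (N + 1), dd c (n + 1) k * ee a k
        = (c + 1 / 2 + n) * ∑ k ∈ Finset.range (N + 1), dd c n k * ee a k
          + ∑ k ∈ Finset.range (N + 1), rr c n k * ee a k := by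
      rw [Finset.mul_sum, ← Finset.sum_add_distrib]
      refine Finset.sum_congr rfl fun k _ => ?_
      rw [dd_rec]; ring
    have hX : (a + 1 / 2) ^ 2 * ∑ k ∈ Finset.range (N + 1), dd c n k * ee a k
        = ∑ k ∈ Finset.range N, dd c n k * ee a (k + 1)
          + ∑ k ∈ Finset.range (N + 1), ((k : ℂ) + 1 / 2) ^ 2 * dd c n k * ee a k := by
      have : ∑ k ∈ Finset.range N, dd c n k * ee a (k + 1)
          = ∑ k ∈ Finset.range (N + 1), dd c n k * ee a (k + 1) := by
        rw [Finset.sum_range_succ, dd_zero c n N (by omega)]; simp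
      rw [this, Finset.mul_sum, ← Finset.sum_add_distrib]
      refine Finset.sum_congr rfl fun k _ => ?_
      rw [ee_succ]; ring
    have hR : ∑ k ∈ Finset.range (N + 1), rr c (n + 1) k * ee a k
        = (c + 1 / 2 + n) * ∑ k ∈ Finset.range (N + 1), rr c n k * ee a k
          + (a + 1 / 2) ^ 2 * ∑ k ∈ Finset.range (N + 1), dd c n k * ee a k := by
      rw [hX, Finset.sum_range_succ', Finset.sum_range_succ' (fun k => rr c n k * ee a k),
        Finset.sum_range_succ' (fun k : ℕ => ((k : ℂ) + 1 / 2) ^ 2 * dd c n k * ee a k), rr_rec0]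
      have : ∑ k ∈ Finset.range N, rr c (n + 1) (k + 1) * ee a (k + 1)
          = (c + 1 / 2 + n) * ∑ k ∈ Finset.range N, rr c n (k + 1) * ee a (k + 1)
          + ∑ k ∈ Finset.range N, dd c n k * ee a (k + 1)
          + ∑ k ∈ Finset.range N,
              (((k + 1 : ℕ) : ℂ) + 1 / 2) ^ 2 * dd c n (k + 1) * ee a (k + 1) := by
        rw [Finset.mul_sum, ← Finset.sum_add_distrib, ← Finset.sum_add_distrib]
        refine Finset.sum_congr rfl fun k _ => ?_
        rw [rr_rec]; push_cast; ring
      rw [this]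
      push_cast
      ring
    rw [hD, hR, poch_succ']
    linear_combination (c + a + 1 + n) * ih

theorem ee_symm (a : ℂ) (k : ℕ) : ee (-a - 1) k = ee a k := by
  simp only [ee]
  rw [show -(-a - 1) = a + 1 by ring, show -a - 1 + 1 = -a by ring]
  ring

theorem main_sum (a c : ℂ) (n : ℕ) :
    poch (c + a + 1) n + poch (c - a) n
      = ∑ k ∈ Finset.range (n / 2 + 1), rr c n k * ee a k := by
  have h1 := two_poch a c (n / 2) n (by omega)
  have h2 := two_poch (-a - 1) c (n / 2) n (by omega)
  simp only [ee_symm] at h2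
  rw [show c + (-a - 1) + 1 = c - a by ring] at h2
  linear_combination (h1 + h2) / 2

theorem numer (n k : ℕ) :
    poch (-(n : ℂ) / 2) k * poch ((1 - (n : ℂ)) / 2) k
      = (n.choose (2 * k) : ℂ) * poch (1 / 2) k * (Nat.factorial k : ℂ) := by
  induction k with
  | zero => simp [poch_zero']
  | succ k ih =>
    have h1 := chooseC n (2 * k)
    have h2 := chooseC n (2 * k + 1)
    rw [show 2 * k + 1 + 1 = 2 * (k + 1) by ring] at h2
    simp only [poch_succ', Nat.factorial_succ]
    push_cast at *
    linear_combination (-(n : ℂ) / 2 + k) * ((1 - (n : ℂ)) / 2 + k) * ih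
      - poch (1 / 2) k * (Nat.factorial k : ℂ) / 4 * ((n : ℂ) - (2 * k + 1)) * h1
      - poch (1 / 2) k * (Nat.factorial k : ℂ) / 4 * (2 * (k : ℂ) + 1) * h2

theorem refl_poch (c : ℂ) (n k : ℕ) (h : k ≤ n) :
    (-1) ^ k * poch c (n - k) * poch (1 - c - (n : ℂ)) k = poch c n := by
  induction k with
  | zero => simp [poch_zero']
  | succ k ih =>
    rw [← ih (by omega)]
    obtain ⟨m, rfl⟩ : ∃ m, n = k + 1 + m := ⟨n - (k + 1), by omega⟩
    rw [show k + 1 + m - (k + 1) = m by omega, show k + 1 + m - k = m + 1 by omega]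
    simp only [poch_succ', pow_succ]
    push_cast
    ring

theorem denom (c : ℂ) (k m : ℕ) :
    (2 * c + ((2 * k + m : ℕ) : ℂ)) * poch c (k + m)
      = c * poch (c + 1) k * (poch (c + k) m + poch (c + k + 1) m) := by
  have h1 : c * poch (c + 1) k = poch c k * (c + k) := by rw [← poch_left, poch_succ']
  have h2 : (c + k) * poch (c + k + 1) m = poch (c + k) m * (c + k + m) := by
    rw [← poch_left, poch_succ']
  rw [h1, poch_add']
  push_cast
  linear_combination -(poch c k) * h2

/-- Terminating balanced ₄F₃-series identity
(the case `b = (a−c)/(2a+n)` of the Hagen–Rothe balanced identity). -/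
theorem hr_balanced_4F3 (n : ℕ) (a c : ℂ)
    (h2cn : 2 * c + (n : ℂ) ≠ 0)
    (hc : ∀ j : ℕ, j ≤ max (n - 1) (n / 2) → c + (j : ℂ) ≠ 0)
    (hcn : ∀ j : ℕ, j < n / 2 → 1 - c - (n : ℂ) + (j : ℂ) ≠ 0) :
    ∑ k ∈ Finset.range (n / 2 + 1),
      poch (-(n : ℂ) / 2) k * poch ((1 - (n : ℂ)) / 2) k * poch (-a) k * poch (a + 1) k /
        (poch (1 / 2) k * poch (c + 1) k * poch (1 - c - (n : ℂ)) k *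
          (Nat.factorial k : ℂ)) =
      c * (poch (c + a + 1) n + poch (c - a) n) / ((2 * c + (n : ℂ)) * poch c n) := by
  have hcn0 : poch c n ≠ 0 := poch_ne _ _ fun j hj => hc j (le_max_of_le_left (by omega))
  rw [eq_div_iff (mul_ne_zero h2cn hcn0), main_sum, Finset.sum_mul, Finset.mul_sum]
  refine Finset.sum_congr rfl fun k hk => ?_
  have hk : k ≤ n / 2 := by have := Finset.mem_range.mp hk; omega
  have n1 : poch (1 / 2) k ≠ 0 := poch_ne _ _ fun j _ => by
    have : ((2 * j + 1 : ℕ) : ℂ) ≠ 0 := Nat.cast_ne_zero.mpr (by omega)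
    intro h
    apply this
    push_cast
    linear_combination 2 * h
  have n2 : poch (c + 1) k ≠ 0 := poch_ne _ _ fun j hj => by
    have := hc (j + 1) (le_max_of_le_right (by omega))
    push_cast at this
    intro h
    apply this
    linear_combination h
  have n3 : poch (1 - c - (n : ℂ)) k ≠ 0 := poch_ne _ _ fun j hj => hcn j (by omega)
  have n4 : (Nat.factorial k : ℂ) ≠ 0 := by exact_mod_cast Nat.factorial_ne_zero k
  rw [numer, div_mul_eq_mul_div, div_eq_iff (mul_ne_zero (mul_ne_zero (mul_ne_zero n1 n2) n3) n4)]
  have hr := refl_poch c n k (by omega)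
  obtain ⟨m, hm⟩ : ∃ m, n = 2 * k + m := ⟨n - 2 * k, by omega⟩
  have hd := denom c k m
  rw [← hm] at hd
  rw [show n - k = k + m by omega] at hr
  rw [← hr, rr, ee, show n - 2 * k = m by omega]
  linear_combination (n.choose (2 * k) : ℂ) * poch (1 / 2) k * (Nat.factorial k : ℂ)
    * poch (-a) k * poch (a + 1) k * (-1) ^ k * poch (1 - c - (n : ℂ)) k * hd
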